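/- arXiv:1805.11023 — 2 statements merged into one kernel-verified Lean document; each statement's English description precedes it below -/
import Mathlib

section
/- Let D ⊆ ℂⁿ be a bounded (p₁, …, pₙ)-quasi-balanced domain containing the origin, and let 𝔥_D be its Minkowski function. Suppose ψ : ℂⁿ → ℝ is C^∞-smooth (infinitely differentiable over ℝ), D = {z ∈ ℂⁿ : ψ(z) < 0}, and for every ξ = (ξ₁, …, ξₙ) ∈ ∂D the real Fréchet derivative satisfies Dψ(ξ)(p₁ ξ₁, …, pₙ ξₙ) ≠ 0. Then 𝔥_D is C^∞-smooth (infinitely differentiable over ℝ) on ℂⁿ \ {0}. -/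
noncomputable section

/-- The weighted action `λ • z = (λ^{p₁} z₁, …, λ^{pₙ} zₙ)` on `ℂⁿ`. -/
def wAct {n : ℕ} (p : Fin n → ℕ) (l : ℂ) (z : Fin n → ℂ) : Fin n → ℂ :=
  fun j => l ^ (p j) * z j

/-- A `(p₁, …, pₙ)`-quasi-balanced domain: a nonempty open connected set that is
stable under `λ • ·` for all `|λ| ≤ 1`. -/
def IsQuasiBalancedDomain {n : ℕ} (p : Fin n → ℕ) (D : Set (Fin n → ℂ)) : Prop :=
  IsOpen D ∧ IsConnected D ∧ ∀ z ∈ D, ∀ l : ℂ, ‖l‖ ≤ 1 → wAct p l z ∈ D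

/-- The Minkowski function `𝔥_D(z) = inf {t > 0 : (1/t) • z ∈ D}`. -/
def mink {n : ℕ} (p : Fin n → ℕ) (D : Set (Fin n → ℂ)) (z : Fin n → ℂ) : ℝ :=
  sInf {t : ℝ | 0 < t ∧ wAct p (1 / (t : ℂ)) z ∈ D}

theorem wAct_wAct {n : ℕ} (p : Fin n → ℕ) (l m : ℂ) (z : Fin n → ℂ) :
    wAct p l (wAct p m z) = wAct p (l * m) z := by
  funext j
  simp only [wAct, mul_pow]
  ring

theorem wAct_cont {n : ℕ} (p : Fin n → ℕ) (l : ℂ) : Continuous (wAct p l) := by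
  unfold wAct
  fun_prop

theorem wAct_mono {n : ℕ} {p : Fin n → ℕ} {D : Set (Fin n → ℂ)}
    (h : ∀ z ∈ D, ∀ l : ℂ, ‖l‖ ≤ 1 → wAct p l z ∈ D) {z : Fin n → ℂ} {t s : ℝ}
    (ht : 0 < t) (hts : t ≤ s) (hz : wAct p (1 / (t : ℂ)) z ∈ D) :
    wAct p (1 / (s : ℂ)) z ∈ D := by
  have hs : 0 < s := ht.trans_le hts
  have h1 := h _ hz ((t / s : ℝ) : ℂ) (by
    rw [Complex.norm_real, Real.norm_of_nonneg (by positivity)]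
    exact (div_le_one hs).2 hts)
  rw [wAct_wAct] at h1
  have ht' : (t : ℂ) ≠ 0 := by exact_mod_cast ht.ne'
  have hs' : (s : ℂ) ≠ 0 := by exact_mod_cast hs.ne'
  have e : ((t / s : ℝ) : ℂ) * (1 / (t : ℂ)) = 1 / (s : ℂ) := by
    push_cast
    field_simp
  rwa [e] at h1

theorem closure_stable {n : ℕ} {p : Fin n → ℕ} {D : Set (Fin n → ℂ)}
    (h : ∀ z ∈ D, ∀ l : ℂ, ‖l‖ ≤ 1 → wAct p l z ∈ D) :
    ∀ z ∈ closure D, ∀ l : ℂ, ‖l‖ ≤ 1 → wAct p l z ∈ closure D := by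
  intro z hz l hl
  exact map_mem_closure (wAct_cont p l) hz (fun w hw => h w hw l hl)

theorem wAct_contDiffAt {n : ℕ} (p : Fin n → ℕ) (v : (Fin n → ℂ) × ℝ) (hv : v.2 ≠ 0) :
    ContDiffAt ℝ (⊤ : ℕ∞) (fun v : (Fin n → ℂ) × ℝ => wAct p (1 / (v.2 : ℂ)) v.1) v := by
  unfold wAct
  rw [contDiffAt_pi]
  intro j
  have h1 : ContDiffAt ℝ (⊤ : ℕ∞) (fun v : (Fin n → ℂ) × ℝ => (v.2 : ℂ)) v :=
    Complex.ofRealCLM.contDiff.contDiffAt.comp v contDiffAt_snd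
  have h2 : ContDiffAt ℝ (⊤ : ℕ∞) (fun v : (Fin n → ℂ) × ℝ => (1 / (v.2 : ℂ))) v := by
    simp only [one_div]
    exact h1.inv (by exact_mod_cast hv)
  have h3 : ContDiffAt ℝ (⊤ : ℕ∞) (fun v : (Fin n → ℂ) × ℝ => v.1 j) v := by fun_prop
  exact (h2.pow (p j)).mul h3

theorem wAct_hasDerivAt {n : ℕ} (p : Fin n → ℕ) (hp : ∀ j, 0 < p j) (z : Fin n → ℂ) (t : ℝ)
    (ht : t ≠ 0) :
    HasDerivAt (fun t : ℝ => wAct p (1 / (t : ℂ)) z)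
      ((-(1 / t)) • (fun j => (p j : ℂ) * wAct p (1 / (t : ℂ)) z j)) t := by
  rw [hasDerivAt_pi]
  intro j
  have ht' : (t : ℂ) ≠ 0 := by exact_mod_cast ht
  have h1 : HasDerivAt (fun t : ℝ => (1 / (t : ℂ))) (-(1 / (t : ℂ) ^ 2)) t := by
    have := (hasDerivAt_inv ht').comp_ofReal
    simpa using this
  have h2 := (h1.pow (p j)).mul_const (z j)
  have e : ((-(1 / t)) • (fun j => (p j : ℂ) * wAct p (1 / (t : ℂ)) z j)) j
      = (p j : ℂ) * (1 / (t : ℂ)) ^ (p j - 1) * -(1 / (t : ℂ) ^ 2) * z j := by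
    obtain ⟨k, hk⟩ : ∃ k, p j = k + 1 := ⟨p j - 1, by have := hp j; omega⟩
    simp only [Pi.smul_apply, Complex.real_smul, wAct, hk, Nat.add_sub_cancel]
    push_cast
    rw [pow_succ]
    ring
  rw [e]
  exact h2

theorem S_nonempty {n : ℕ} (p : Fin n → ℕ) (hp : ∀ j, 0 < p j) (D : Set (Fin n → ℂ))
    (hD : IsOpen D) (h0 : 0 ∈ D) (z : Fin n → ℂ) :
    {t : ℝ | 0 < t ∧ wAct p (1 / (t : ℂ)) z ∈ D}.Nonempty := by
  have hc : Continuous (fun s : ℝ => wAct p (s : ℂ) z) := by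
    unfold wAct
    fun_prop
  have h00 : wAct p ((0 : ℝ) : ℂ) z = 0 := by
    funext j
    simp [wAct, (hp j).ne']
  have hn : (fun s : ℝ => wAct p (s : ℂ) z) ⁻¹' D ∈ nhds (0 : ℝ) :=
    (hD.preimage hc).mem_nhds (by rw [Set.mem_preimage, h00]; exact h0)
  obtain ⟨ε, hε, hb⟩ := Metric.mem_nhds_iff.1 hn
  refine ⟨2 / ε, by positivity, ?_⟩
  have := hb (show ε / 2 ∈ Metric.ball (0 : ℝ) ε by
    rw [Metric.mem_ball, Real.dist_eq, sub_zero, abs_of_pos (by positivity)]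
    linarith)
  have e : (1 / ((2 / ε : ℝ) : ℂ)) = ((ε / 2 : ℝ) : ℂ) := by
    push_cast
    rw [one_div_div]
  rw [e]
  exact this

theorem S_lower {n : ℕ} (p : Fin n → ℕ) (hp : ∀ j, 0 < p j) (D : Set (Fin n → ℂ))
    (hb : Bornology.IsBounded D) (z : Fin n → ℂ) (hz : z ≠ 0) :
    ∃ ε > 0, ∀ t ∈ {t : ℝ | 0 < t ∧ wAct p (1 / (t : ℂ)) z ∈ D}, ε ≤ t := by
  obtain ⟨j, hj⟩ : ∃ j, z j ≠ 0 := by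
    by_contra! h
    exact hz (funext h)
  obtain ⟨R, hR, hRD⟩ := hb.exists_pos_norm_le
  have hzj : 0 < ‖z j‖ := norm_pos_iff.2 hj
  refine ⟨min 1 (‖z j‖ / R), by positivity, ?_⟩
  rintro t ⟨ht, htD⟩
  by_contra! hlt
  have ht1 : t < 1 := hlt.trans_le (min_le_left _ _)
  have ht2 : t < ‖z j‖ / R := hlt.trans_le (min_le_right _ _)
  rw [lt_div_iff₀ hR] at ht2
  have h1 := (norm_le_pi_norm _ j).trans (hRD _ htD)
  simp only [wAct, norm_mul, norm_pow, norm_div, norm_one, Complex.norm_real,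
    Real.norm_of_nonneg ht.le] at h1
  have h2 : t ^ (p j) ≤ t := pow_le_of_le_one ht.le ht1.le (hp j).ne'
  have h3 : 0 < t ^ (p j) := by positivity
  rw [div_pow, one_pow, one_div_mul_eq_div, div_le_iff₀ h3] at h1
  nlinarith

/-- Main smoothness theorem: if a bounded quasi-balanced domain containing the origin
has a `C^∞` global defining function `ψ` with `D = {ψ < 0}` which is transversal to
the weighted radial direction at every boundary point, then the Minkowski function
is `C^∞` on `ℂⁿ \ {0}`. -/
theorem mink_smooth {n : ℕ} (p : Fin n → ℕ) (hp : ∀ j, 0 < p j)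
    (D : Set (Fin n → ℂ)) (hD : IsQuasiBalancedDomain p D)
    (hbdd : Bornology.IsBounded D) (h0 : 0 ∈ D)
    (ψ : (Fin n → ℂ) → ℝ) (hψ : ContDiff ℝ (⊤ : ℕ∞) ψ)
    (hDψ : D = {z : Fin n → ℂ | ψ z < 0})
    (htrans : ∀ ξ ∈ frontier D, fderiv ℝ ψ ξ (fun j => (p j : ℂ) * ξ j) ≠ 0) :
    ContDiffOn ℝ (⊤ : ℕ∞) (mink p D) {(0 : Fin n → ℂ)}ᶜ := by
  obtain ⟨hopen, -, hst⟩ := hD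
  -- basic facts on the Minkowski function
  have hbdd' : ∀ z, BddBelow {t : ℝ | 0 < t ∧ wAct p (1 / (t : ℂ)) z ∈ D} :=
    fun z => ⟨0, fun t ht => ht.1.le⟩
  have hpos : ∀ z, z ≠ 0 → 0 < mink p D z := by
    intro z hz
    obtain ⟨ε, hε, h⟩ := S_lower p hp D hbdd z hz
    exact hε.trans_le (le_csInf (S_nonempty p hp D hopen h0 z) h)
  have hgt : ∀ z (t : ℝ), z ≠ 0 → mink p D z < t → wAct p (1 / (t : ℂ)) z ∈ D := by
    intro z t hz ht
    obtain ⟨s, hs, hst'⟩ := exists_lt_of_csInf_lt (S_nonempty p hp D hopen h0 z) ht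
    exact wAct_mono hst hs.1 hst'.le hs.2
  have hle : ∀ z (t : ℝ), 0 < t → wAct p (1 / (t : ℂ)) z ∈ D → mink p D z ≤ t :=
    fun z t ht h => csInf_le (hbdd' z) ⟨ht, h⟩
  have hct : ∀ z (t : ℝ), t ≠ 0 → ContinuousAt (fun t : ℝ => wAct p (1 / (t : ℂ)) z) t :=
    fun z t ht => (wAct_hasDerivAt p hp z t ht).continuousAt
  have hcz : ∀ t : ℝ, Continuous (fun z => wAct p (1 / (t : ℂ)) z) := fun t => wAct_cont p _
  have hnot : ∀ z, z ≠ 0 → wAct p (1 / (mink p D z : ℂ)) z ∉ D := by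
    intro z hz hmem
    have h1 := (hct z _ (hpos z hz).ne').eventually (hopen.mem_nhds hmem)
    have h2 : ∀ᶠ t in nhds (mink p D z), 0 < t := lt_mem_nhds (hpos z hz)
    have h3 : ∀ᶠ t in nhdsWithin (mink p D z) (Set.Iio (mink p D z)), False := by
      filter_upwards [nhdsWithin_le_nhds h1, nhdsWithin_le_nhds h2, self_mem_nhdsWithin]
        with t a b c
      exact absurd (hle z t b a) (not_le.2 c)
    exact h3.exists.elim (fun _ h => h)
  have hcl : ∀ z, z ≠ 0 → wAct p (1 / (mink p D z : ℂ)) z ∈ closure D := by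
    intro z hz
    have h1 : Filter.Tendsto (fun t : ℝ => wAct p (1 / (t : ℂ)) z)
        (nhdsWithin (mink p D z) (Set.Ioi (mink p D z))) (nhds _) :=
      (hct z _ (hpos z hz).ne').tendsto.mono_left nhdsWithin_le_nhds
    refine mem_closure_of_tendsto h1 ?_
    filter_upwards [self_mem_nhdsWithin] with t ht
    exact hgt z t hz ht
  have hψcl : ∀ w ∈ closure D, ψ w ≤ 0 := by
    intro w hw
    have : closure D ⊆ {w | ψ w ≤ 0} := by
      refine closure_minimal ?_ (isClosed_le hψ.continuous continuous_const)
      intro w hw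
      rw [hDψ] at hw
      exact le_of_lt (show ψ w < 0 from hw)
    exact this hw
  have hψ0 : ∀ w, w ∈ closure D → w ∉ D → ψ w = 0 := by
    intro w hw hw'
    refine le_antisymm (hψcl w hw) ?_
    rw [hDψ] at hw'
    exact not_lt.1 hw'
  have hderiv : ∀ z (t : ℝ), t ≠ 0 → HasDerivAt (fun t : ℝ => ψ (wAct p (1 / (t : ℂ)) z))
      (-(1 / t) * fderiv ℝ ψ (wAct p (1 / (t : ℂ)) z)
        (fun j => (p j : ℂ) * wAct p (1 / (t : ℂ)) z j)) t := by
    intro z t ht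
    have h1 := ((hψ.differentiable (by simp)) (wAct p (1 / (t : ℂ)) z)).hasFDerivAt
    have h2 := h1.comp_hasDerivAt t (wAct_hasDerivAt p hp z t ht)
    rw [map_smul, smul_eq_mul] at h2
    exact h2
  have hdne : ∀ z (t : ℝ), 0 < t → wAct p (1 / (t : ℂ)) z ∈ closure D →
      wAct p (1 / (t : ℂ)) z ∉ D → -(1 / t) * fderiv ℝ ψ (wAct p (1 / (t : ℂ)) z)
        (fun j => (p j : ℂ) * wAct p (1 / (t : ℂ)) z j) ≠ 0 := by
    intro z t ht h1 h2
    refine mul_ne_zero (by simpa using ht.ne') (htrans _ ?_)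
    rw [hopen.frontier_eq]
    exact ⟨h1, h2⟩
  have hnc : ∀ z (s : ℝ), z ≠ 0 → 0 < s → s < mink p D z →
      wAct p (1 / (s : ℂ)) z ∉ closure D := by
    intro z s hz hs hsm hmem
    have hcl' : ∀ t : ℝ, s ≤ t → wAct p (1 / (t : ℂ)) z ∈ closure D :=
      fun t ht => wAct_mono (closure_stable hst) hs ht hmem
    have hn' : ∀ t : ℝ, s ≤ t → t < mink p D z → wAct p (1 / (t : ℂ)) z ∉ D :=
      fun t ht1 ht2 h => absurd (hle z t (hs.trans_le ht1) h) (not_le.2 ht2)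
    obtain ⟨t, ht1, ht2⟩ := exists_between hsm
    have htp : 0 < t := hs.trans ht1
    have hz0 : (fun t : ℝ => ψ (wAct p (1 / (t : ℂ)) z)) =ᶠ[nhds t] fun _ => (0 : ℝ) := by
      filter_upwards [Ioo_mem_nhds ht1 ht2] with r hr
      exact hψ0 _ (hcl' r hr.1.le) (hn' r hr.1.le hr.2)
    have h1 := (hasDerivAt_const t (0 : ℝ)).congr_of_eventuallyEq hz0
    exact hdne z t htp (hcl' t ht1.le) (hn' t ht1.le ht2) ((hderiv z t htp.ne').unique h1)
  -- continuity
  have hcont : ∀ z, z ≠ 0 → ContinuousAt (mink p D) z := by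
    intro z hz
    have hzn : ∀ᶠ w in nhds z, w ≠ 0 := isOpen_ne.mem_nhds hz
    refine tendsto_order.2 ⟨fun a ha => ?_, fun b hb => ?_⟩
    · obtain ⟨s, hs1, hs2⟩ := exists_between (max_lt ha (hpos z hz))
      have hs : 0 < s := (le_max_right _ _).trans_lt hs1
      have ho : IsOpen {w | wAct p (1 / (s : ℂ)) w ∈ (closure D)ᶜ} :=
        isClosed_closure.isOpen_compl.preimage (hcz s)
      filter_upwards [ho.mem_nhds (hnc z s hz hs hs2), hzn] with w hw hw0
      refine ((le_max_left _ _).trans_lt hs1).trans_le ?_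
      by_contra! hlt
      exact hw (subset_closure (hgt w s hw0 hlt))
    · obtain ⟨s, hs1, hs2⟩ := exists_between hb
      have ho : IsOpen {w | wAct p (1 / (s : ℂ)) w ∈ D} := hopen.preimage (hcz s)
      filter_upwards [ho.mem_nhds (hgt z s hz hs1)] with w hw
      exact (hle w s ((hpos z hz).trans hs1) hw).trans_lt hs2
  -- implicit function theorem
  intro z hz
  have hz : z ≠ 0 := hz
  refine ContDiffAt.contDiffWithinAt ?_
  set t₀ := mink p D z with ht₀
  have htp : 0 < t₀ := hpos z hz
  let F : (Fin n → ℂ) × ℝ → ℝ := fun v => ψ (wAct p (1 / (v.2 : ℂ)) v.1)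
  have cdf : ContDiffAt ℝ (⊤ : ℕ∞) F (z, t₀) :=
    hψ.contDiffAt.comp (z, t₀) (wAct_contDiffAt p (z, t₀) htp.ne')
  have pn : ((⊤ : ℕ∞) : WithTop ℕ∞) ≠ 0 := by simp
  have hF0 : ∀ w, w ≠ 0 → F (w, mink p D w) = 0 := fun w hw => hψ0 _ (hcl w hw) (hnot w hw)
  have if₂ : (fderiv ℝ F (z, t₀) ∘L .inr ℝ (Fin n → ℂ) ℝ).IsInvertible := by
    set L := fderiv ℝ F (z, t₀) ∘L .inr ℝ (Fin n → ℂ) ℝ with hL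
    have h1 : HasFDerivAt F (fderiv ℝ F (z, t₀)) (z, t₀) :=
      (cdf.differentiableAt pn).hasFDerivAt
    have h2 : HasFDerivAt (fun t : ℝ => F (z, t)) L t₀ :=
      h1.comp t₀ (hasFDerivAt_prodMk_right z t₀)
    have h3 : L 1 ≠ 0 := by
      have h4 := h2.hasDerivAt.unique (hderiv z t₀ htp.ne')
      rw [h4]
      exact hdne z t₀ htp (hcl z hz) (hnot z hz)
    refine ⟨ContinuousLinearEquiv.unitsEquivAut ℝ (Units.mk0 (L 1) h3), ?_⟩
    ext
    simp
  have h5 := (cdf.eventually_apply_eq_iff_implicitFunction pn if₂)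
  have h6 : Filter.Tendsto (fun w => (w, mink p D w)) (nhds z) (nhds (z, t₀)) :=
    (continuousAt_id.prodMk (hcont z hz))
  have h7 : mink p D =ᶠ[nhds z] cdf.implicitFunction pn if₂ := by
    have hzn : ∀ᶠ w in nhds z, w ≠ 0 := isOpen_ne.mem_nhds hz
    filter_upwards [h6.eventually h5, hzn] with w hw hw0
    exact (hw.1 (by rw [hF0 w hw0, hF0 z hz])).symm
  exact (cdf.contDiffAt_implicitFunction pn if₂).congr_of_eventuallyEq h7
end
end

section
/- Let D ⊆ ℂⁿ be a bounded (p₁, …, pₙ)-quasi-balanced domain containing the origin, and let 𝔥_D be its Minkowski function. Suppose ψ : ℂⁿ → ℝ is C^∞-smooth (infinitely differentiable over ℝ), D = {z ∈ ℂⁿ : ψ(z) < 0}, and for every ξ = (ξ₁, …, ξₙ) ∈ ∂D the real Fréchet derivative satisfies Dψ(ξ)(p₁ ξ₁, …, pₙ ξₙ) ≠ 0. Then the function r(z) := 𝔥_D(z) − 1 is a defining function for D away from the origin: r is C^∞-smooth on ℂⁿ \ {0}, D = {z ∈ ℂⁿ : r(z) < 0}, ∂D = {z ∈ ℂⁿ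 : r(z) = 0}, and the real Fréchet derivative Dr(ξ) is nonzero at every point ξ ∈ ∂D. -/
noncomputable section

theorem wAct_mul_aux {n : ℕ} (p : Fin n → ℕ) (a b : ℂ) (z : Fin n → ℂ) :
    wAct p (a * b) z = wAct p a (wAct p b z) := by
  funext j
  simp only [wAct, mul_pow, mul_assoc]

theorem wAct_one_aux {n : ℕ} (p : Fin n → ℕ) (z : Fin n → ℂ) : wAct p 1 z = z := by
  funext j
  simp [wAct]

theorem wAct_zero_aux {n : ℕ} (p : Fin n → ℕ) (l : ℂ) : wAct p l 0 = 0 := by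
  funext j
  simp [wAct]

theorem wAct_contDiff_aux {n : ℕ} (p : Fin n → ℕ) :
    ContDiff ℝ (⊤ : ℕ∞) (fun x : (Fin n → ℂ) × ℝ => wAct p (x.2 : ℂ) x.1) := by
  unfold wAct
  rw [contDiff_pi]
  intro j
  have h1 : ContDiff ℝ (⊤ : ℕ∞) (fun x : (Fin n → ℂ) × ℝ => (x.2 : ℂ)) :=
    Complex.ofRealCLM.contDiff.comp contDiff_snd
  have h2 : ContDiff ℝ (⊤ : ℕ∞) (fun x : (Fin n → ℂ) × ℝ => x.1 j) := by fun_prop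
  exact (h1.pow _).mul h2

theorem wAct_cont_aux {n : ℕ} (p : Fin n → ℕ) (z : Fin n → ℂ) :
    Continuous (fun s : ℝ => wAct p (s : ℂ) z) :=
  (wAct_contDiff_aux p).continuous.comp (by fun_prop : Continuous fun s : ℝ => (z, s))

theorem wAct_cont_aux2 {n : ℕ} (p : Fin n → ℕ) (s : ℝ) :
    Continuous (fun z : Fin n → ℂ => wAct p (s : ℂ) z) :=
  (wAct_contDiff_aux p).continuous.comp (by fun_prop : Continuous fun z : Fin n → ℂ => (z, s))

theorem wAct_deriv_aux {n : ℕ} (p : Fin n → ℕ) (hp : ∀ j, 0 < p j) (z : Fin n → ℂ) (s : ℝ)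
    (hs : 0 < s) :
    HasDerivAt (fun s : ℝ => wAct p (s : ℂ) z)
      (s⁻¹ • fun j => (p j : ℂ) * (wAct p (s : ℂ) z) j) s := by
  rw [hasDerivAt_pi]
  intro j
  have h1 : HasDerivAt (fun s : ℝ => (s : ℂ)) 1 s := Complex.ofRealCLM.hasDerivAt
  have h2 := (h1.pow (p j)).mul_const (z j)
  have hs' : (s : ℂ) ≠ 0 := by exact_mod_cast hs.ne'
  convert! h2 using 1
  obtain ⟨k, hk⟩ : ∃ k, p j = k + 1 := ⟨p j - 1, by have := hp j; omega⟩
  simp only [wAct, hk, Pi.smul_apply, Complex.real_smul]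
  push_cast
  field_simp
  ring

theorem mink_pos_aux {n : ℕ} (p : Fin n → ℕ) (hp : ∀ j, 0 < p j)
    (D : Set (Fin n → ℂ)) (hD : IsQuasiBalancedDomain p D)
    (hbdd : Bornology.IsBounded D) (h0 : 0 ∈ D) (z : Fin n → ℂ) :
    (z ≠ 0 → 0 < mink p D z) ∧
      ∀ t : ℝ, 0 < t → (wAct p (1 / (t : ℂ)) z ∈ D ↔ mink p D z < t) := by
  obtain ⟨hopen, -, hbal⟩ := hD
  set S : Set ℝ := {t : ℝ | 0 < t ∧ wAct p (1 / (t : ℂ)) z ∈ D} with hS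
  have hm : mink p D z = sInf S := rfl
  have hbb : BddBelow S := ⟨0, fun t ht => ht.1.le⟩
  have hne : S.Nonempty := by
    have h1 : ∀ᶠ s : ℝ in nhds 0, wAct p (s : ℂ) z ∈ D := by
      apply (wAct_cont_aux p z).continuousAt.eventually_mem
      have : wAct p ((0 : ℝ) : ℂ) z = 0 := by
        funext j
        simp [wAct, (hp j).ne']
      rw [this]
      exact hopen.mem_nhds h0
    obtain ⟨s, hs, hs0⟩ := ((h1.filter_mono nhdsWithin_le_nhds).and
      (self_mem_nhdsWithin : Set.Ioi (0 : ℝ) ∈ nhdsWithin 0 (Set.Ioi 0))).exists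
    refine ⟨1 / s, one_div_pos.2 hs0, ?_⟩
    simpa using hs
  have hup : ∀ t ∈ S, ∀ u, t ≤ u → u ∈ S := by
    intro t ht u hu
    have ht0 : 0 < t := ht.1
    have hu0 : 0 < u := ht0.trans_le hu
    refine ⟨hu0, ?_⟩
    have h1 : (1 / (u : ℂ)) = ((t / u : ℝ) : ℂ) * (1 / (t : ℂ)) := by
      have : (t : ℂ) ≠ 0 := by exact_mod_cast ht0.ne'
      push_cast
      field_simp
    rw [h1, wAct_mul_aux]
    apply hbal _ ht.2
    rw [Complex.norm_real, Real.norm_of_nonneg (by positivity)]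
    exact (div_le_one hu0).2 hu
  have hdown : ∀ t ∈ S, ∃ u ∈ S, u < t := by
    intro t ht
    have ht0 : 0 < t := ht.1
    have hc : ContinuousAt (fun t : ℝ => wAct p (((1 / t : ℝ)) : ℂ) z) t := by
      apply ContinuousAt.comp (g := fun s : ℝ => wAct p (s : ℂ) z) (f := fun t : ℝ => 1 / t)
      · exact (wAct_cont_aux p z).continuousAt
      · exact continuousAt_const.div continuousAt_id ht0.ne'
    have h1 : ∀ᶠ u : ℝ in nhds t, wAct p (((1 / u : ℝ)) : ℂ) z ∈ D := by
      apply hc.eventually_mem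
      apply hopen.mem_nhds
      simpa using ht.2
    obtain ⟨u, ⟨hu, hu0⟩, hut⟩ := (((h1.and (lt_mem_nhds ht0)).filter_mono nhdsWithin_le_nhds).and
      (self_mem_nhdsWithin : Set.Iio t ∈ nhdsWithin t (Set.Iio t))).exists
    exact ⟨u, ⟨hu0, by simpa using hu⟩, hut⟩
  constructor
  · intro hz
    obtain ⟨j, hj⟩ : ∃ j, z j ≠ 0 := by
      by_contra! h
      exact hz (funext h)
    obtain ⟨R, hR0, hR⟩ := hbdd.exists_pos_norm_le
    have hzj : 0 < ‖z j‖ := norm_pos_iff.2 hj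
    refine lt_of_lt_of_le (lt_min one_pos (div_pos hzj hR0)) (le_csInf hne ?_)
    intro t ht
    have ht0 : 0 < t := ht.1
    by_cases h1 : t ≤ 1
    · apply min_le_of_right_le
      have h2 := (norm_le_pi_norm _ j).trans (hR _ ht.2)
      simp only [wAct, norm_mul, norm_pow, norm_div, norm_one, Complex.norm_real,
        Real.norm_of_nonneg ht0.le] at h2
      rw [div_le_iff₀ hR0]
      have h3 : t ^ p j ≤ t := pow_le_of_le_one ht0.le h1 (hp j).ne'
      rw [one_div, inv_pow, inv_mul_le_iff₀ (by positivity)] at h2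
      exact h2.trans (mul_le_mul_of_nonneg_right h3 hR0.le)
    · exact min_le_of_left_le (not_le.1 h1).le
  · intro t ht
    rw [hm]
    constructor
    · intro h
      obtain ⟨u, hu, hut⟩ := hdown t ⟨ht, h⟩
      exact (csInf_le hbb hu).trans_lt hut
    · intro h
      obtain ⟨u, hu, hut⟩ := exists_lt_of_csInf_lt hne h
      exact (hup u hu t hut.le).2

theorem mink_key_aux {n : ℕ} (p : Fin n → ℕ) (hp : ∀ j, 0 < p j)
    (D : Set (Fin n → ℂ)) (hD : IsQuasiBalancedDomain p D)
    (hbdd : Bornology.IsBounded D) (h0 : 0 ∈ D) (z : Fin n → ℂ) (s : ℝ) (hs : 0 < s) :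
    wAct p (s : ℂ) z ∈ D ↔ s * mink p D z < 1 := by
  have := (mink_pos_aux p hp D hD hbdd h0 z).2 (1 / s) (one_div_pos.2 hs)
  rw [lt_div_iff₀ hs, mul_comm] at this
  simpa using this

theorem mink_homog_aux {n : ℕ} (p : Fin n → ℕ) (hp : ∀ j, 0 < p j)
    (D : Set (Fin n → ℂ)) (hD : IsQuasiBalancedDomain p D)
    (hbdd : Bornology.IsBounded D) (h0 : 0 ∈ D) (z : Fin n → ℂ) (hz : z ≠ 0)
    (s : ℝ) (hs : 0 < s) :
    mink p D (wAct p (s : ℂ) z) = s * mink p D z := by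
  have hpos := (mink_pos_aux p hp D hD hbdd h0 z).1 hz
  have hsz : wAct p (s : ℂ) z ≠ 0 := by
    intro h
    apply hz
    have hs' : (s : ℂ) ≠ 0 := by exact_mod_cast hs.ne'
    rw [← wAct_one_aux p z, ← inv_mul_cancel₀ hs', wAct_mul_aux, h, wAct_zero_aux]
  have hpos2 := (mink_pos_aux p hp D hD hbdd h0 _).1 hsz
  have key : ∀ u : ℝ, 0 < u → (u * mink p D (wAct p (s : ℂ) z) < 1 ↔ u * (s * mink p D z) < 1) := by
    intro u hu
    rw [← mink_key_aux p hp D hD hbdd h0 _ u hu, ← wAct_mul_aux, ← Complex.ofReal_mul,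
      mink_key_aux p hp D hD hbdd h0 _ _ (mul_pos hu hs), mul_assoc]
  generalize mink p D (wAct p (s : ℂ) z) = a at *
  have hb : 0 < s * mink p D z := mul_pos hs hpos
  generalize s * mink p D z = b at *
  apply le_antisymm
  · by_contra! h
    have := (key a⁻¹ (inv_pos.2 hpos2)).2 (by rwa [inv_mul_lt_iff₀ hpos2, mul_one])
    rw [inv_mul_cancel₀ hpos2.ne'] at this
    exact lt_irrefl _ this
  · by_contra! h
    have := (key b⁻¹ (inv_pos.2 hb)).1 (by rwa [inv_mul_lt_iff₀ hb, mul_one])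
    rw [inv_mul_cancel₀ hb.ne'] at this
    exact lt_irrefl _ this

/-- A point with `mink = 1` is a boundary point. -/
theorem mink_frontier_aux {n : ℕ} (p : Fin n → ℕ) (hp : ∀ j, 0 < p j)
    (D : Set (Fin n → ℂ)) (hD : IsQuasiBalancedDomain p D)
    (hbdd : Bornology.IsBounded D) (h0 : 0 ∈ D) (z : Fin n → ℂ) (hz : mink p D z = 1) :
    z ∈ frontier D := by
  have key := mink_key_aux p hp D hD hbdd h0 z
  rw [hD.1.frontier_eq]
  constructor
  · have h1 : Filter.Tendsto (fun s : ℝ => wAct p (s : ℂ) z) (nhdsWithin 1 (Set.Iio 1))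
        (nhds z) := by
      have := (wAct_cont_aux p z).tendsto 1
      simp only [Complex.ofReal_one, wAct_one_aux] at this
      exact this.mono_left nhdsWithin_le_nhds
    apply mem_closure_of_tendsto h1
    filter_upwards [self_mem_nhdsWithin,
      (lt_mem_nhds (one_pos : (0 : ℝ) < 1)).filter_mono nhdsWithin_le_nhds] with s hs hs0
    rw [key s hs0, hz, mul_one]
    exact hs
  · intro h
    have := (key 1 one_pos).1 (by simpa [wAct_one_aux] using h)
    rw [hz] at this
    norm_num at this

theorem mink_smooth_aux {n : ℕ} (p : Fin n → ℕ) (hp : ∀ j, 0 < p j)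
    (D : Set (Fin n → ℂ)) (hD : IsQuasiBalancedDomain p D)
    (hbdd : Bornology.IsBounded D) (h0 : 0 ∈ D)
    (ψ : (Fin n → ℂ) → ℝ) (hψ : ContDiff ℝ (⊤ : ℕ∞) ψ)
    (hDψ : D = {z : Fin n → ℂ | ψ z < 0})
    (htrans : ∀ ξ ∈ frontier D, fderiv ℝ ψ ξ (fun j => (p j : ℂ) * ξ j) ≠ 0)
    (z₀ : Fin n → ℂ) (hz₀ : z₀ ≠ 0) :
    ContDiffAt ℝ (⊤ : ℕ∞) (fun z => mink p D z) z₀ := by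
  have key := mink_key_aux p hp D hD hbdd h0
  have hpos := fun z => (mink_pos_aux p hp D hD hbdd h0 z).1
  have hmem : ∀ z, z ∈ D ↔ ψ z < 0 := fun z => by rw [hDψ]; rfl
  have hψfr : ∀ ξ ∈ frontier D, ψ ξ = 0 := by
    intro ξ hξ
    rw [hD.1.frontier_eq] at hξ
    apply le_antisymm
    · have : closure D ⊆ {z | ψ z ≤ 0} :=
        closure_minimal (fun z hz => ((hmem z).1 hz).le)
          (isClosed_le hψ.continuous continuous_const)
      exact this hξ.1
    · exact not_lt.1 fun h => hξ.2 ((hmem ξ).2 h)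
  set g : (Fin n → ℂ) → ℝ := fun z => (mink p D z)⁻¹ with hg
  have hgpos : ∀ z, z ≠ 0 → 0 < g z := fun z hz => inv_pos.2 (hpos z hz)
  have hgfr : ∀ z, z ≠ 0 → wAct p (g z : ℂ) z ∈ frontier D := by
    intro z hz
    apply mink_frontier_aux p hp D hD hbdd h0
    rw [mink_homog_aux p hp D hD hbdd h0 z hz _ (hgpos z hz)]
    exact inv_mul_cancel₀ (hpos z hz).ne'
  have key' : ∀ z, z ≠ 0 → ∀ s : ℝ, 0 < s → (wAct p (s : ℂ) z ∈ D ↔ s < g z) := by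
    intro z hz s hs
    rw [key z s hs, show g z = 1 / mink p D z from (one_div _).symm, lt_div_iff₀ (hpos z hz)]
  set F : (Fin n → ℂ) × ℝ → ℝ := fun x => ψ (wAct p (x.2 : ℂ) x.1) with hF
  have hFs : ContDiff ℝ (⊤ : ℕ∞) F := hψ.comp (wAct_contDiff_aux p)
  have hFg : ∀ z, z ≠ 0 → F (z, g z) = 0 := fun z hz => hψfr _ (hgfr z hz)
  have hs₀ := hgpos z₀ hz₀
  set s₀ := g z₀ with hs₀def
  set d : ℝ := s₀⁻¹ * fderiv ℝ ψ (wAct p (s₀ : ℂ) z₀)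
    (fun j => (p j : ℂ) * (wAct p (s₀ : ℂ) z₀) j) with hd
  have hd0 : d ≠ 0 := mul_ne_zero (inv_ne_zero hs₀.ne') (htrans _ (hgfr z₀ hz₀))
  have hder : HasDerivAt (fun s : ℝ => F (z₀, s)) d s₀ := by
    have h1 := wAct_deriv_aux p hp z₀ s₀ hs₀
    have h2 : HasFDerivAt ψ (fderiv ℝ ψ (wAct p (s₀ : ℂ) z₀)) (wAct p (s₀ : ℂ) z₀) :=
      ((hψ.differentiable (by simp)) _).hasFDerivAt
    have h3 := h2.comp_hasDerivAt s₀ h1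
    rw [map_smul, smul_eq_mul] at h3
    exact h3
  have hne0 : ∀ᶠ z in nhds z₀, z ≠ 0 := isOpen_ne.mem_nhds hz₀
  -- continuity of g
  have hgc : ContinuousAt g z₀ := by
    rw [ContinuousAt, tendsto_order]
    constructor
    · intro a ha
      have hb : max a (s₀ / 2) < s₀ := max_lt ha (by linarith)
      have hb0 : 0 < max a (s₀ / 2) := lt_max_of_lt_right (by linarith)
      set b := max a (s₀ / 2)
      have h1 : ∀ᶠ z in nhds z₀, wAct p (b : ℂ) z ∈ D :=
        (wAct_cont_aux2 p b).continuousAt.eventually_mem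
          (hD.1.mem_nhds ((key' z₀ hz₀ b hb0).2 hb))
      filter_upwards [h1, hne0] with z hz hz0
      exact (le_max_left _ _).trans_lt ((key' z hz0 b hb0).1 hz)
    · intro a ha
      have h1 : ∀ᶠ s in nhdsWithin s₀ (Set.Ioi s₀), F (z₀, s) ≠ 0 :=
        (hder.eventually_ne hd0).filter_mono
          (nhdsWithin_mono _ fun s hs => ne_of_gt hs)
      obtain ⟨s, ⟨hs1, hs2⟩, hsa⟩ := ((h1.and self_mem_nhdsWithin).and
        ((gt_mem_nhds ha).filter_mono nhdsWithin_le_nhds)).exists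
      have hs2 : s₀ < s := hs2
      have hsp : 0 < s := hs₀.trans hs2
      have h2 : 0 < F (z₀, s) := by
        refine lt_of_le_of_ne (not_lt.1 fun h => ?_) hs1.symm
        exact lt_asymm hs2 ((key' z₀ hz₀ s hsp).1 ((hmem _).2 h))
      have h3 : ∀ᶠ z in nhds z₀, 0 < F (z, s) := by
        have hc : Continuous fun z => F (z, s) := hFs.continuous.comp (by fun_prop)
        exact hc.continuousAt.eventually (lt_mem_nhds h2)
      filter_upwards [h3, hne0] with z hz hz0
      refine lt_of_le_of_lt (not_lt.1 fun h => ?_) hsa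
      exact lt_asymm hz ((hmem _).1 ((key' z hz0 s hsp).2 h))
  -- implicit function theorem
  have hn : ((⊤ : ℕ∞) : WithTop ℕ∞) ≠ 0 := by simp
  have cdf : ContDiffAt ℝ (⊤ : ℕ∞) F (z₀, s₀) := hFs.contDiffAt
  have hinv : (fderiv ℝ F (z₀, s₀) ∘L .inr ℝ (Fin n → ℂ) ℝ).IsInvertible := by
    have h1 : HasFDerivAt F (fderiv ℝ F (z₀, s₀)) (z₀, s₀) :=
      (cdf.differentiableAt hn).hasFDerivAt
    have h2 : HasFDerivAt (fun s : ℝ => F (z₀, s))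
        (fderiv ℝ F (z₀, s₀) ∘L .inr ℝ (Fin n → ℂ) ℝ) s₀ :=
      h1.comp s₀ (hasFDerivAt_prodMk_right z₀ s₀)
    have h3 := h2.unique hder.hasFDerivAt
    rw [h3]
    refine ⟨ContinuousLinearEquiv.unitsEquivAut ℝ (Units.mk0 d hd0), ?_⟩
    ext
    simp
  have hsm := cdf.contDiffAt_implicitFunction hn hinv
  have huniq := cdf.eventually_apply_eq_iff_implicitFunction hn hinv
  have htend : Filter.Tendsto (fun z => (z, g z)) (nhds z₀) (nhds (z₀, s₀)) :=
    (continuousAt_id.prodMk hgc)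
  have heq : g =ᶠ[nhds z₀] cdf.implicitFunction hn hinv := by
    filter_upwards [htend.eventually huniq, hne0] with z hz hz0
    exact (hz.1 ((hFg z hz0).trans (hFg z₀ hz₀).symm)).symm
  have hgs : ContDiffAt ℝ (⊤ : ℕ∞) g z₀ := hsm.congr_of_eventuallyEq heq
  have := hgs.inv hs₀.ne'
  have he : (fun z => mink p D z) = g⁻¹ := by
    funext z
    simp [hg]
  rw [he]
  exact this

/-- Under the hypotheses of the main theorem, `r = 𝔥_D - 1` is a defining function
for `D` away from the origin: it is `C^∞` on `ℂⁿ \ {0}`, `D = {r < 0}`,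
`∂D = {r = 0}`, and `dr ≠ 0` on `∂D`. -/
theorem mink_defining_function {n : ℕ} (p : Fin n → ℕ) (hp : ∀ j, 0 < p j)
    (D : Set (Fin n → ℂ)) (hD : IsQuasiBalancedDomain p D)
    (hbdd : Bornology.IsBounded D) (h0 : 0 ∈ D)
    (ψ : (Fin n → ℂ) → ℝ) (hψ : ContDiff ℝ (⊤ : ℕ∞) ψ)
    (hDψ : D = {z : Fin n → ℂ | ψ z < 0})
    (htrans : ∀ ξ ∈ frontier D, fderiv ℝ ψ ξ (fun j => (p j : ℂ) * ξ j) ≠ 0) :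
    ContDiffOn ℝ (⊤ : ℕ∞) (fun z => mink p D z - 1) {(0 : Fin n → ℂ)}ᶜ ∧
      D = {z : Fin n → ℂ | mink p D z - 1 < 0} ∧
      frontier D = {z : Fin n → ℂ | mink p D z - 1 = 0} ∧
      ∀ ξ ∈ frontier D, fderiv ℝ (fun z => mink p D z - 1) ξ ≠ 0 := by
  have key := mink_key_aux p hp D hD hbdd h0
  have hpos := fun z => (mink_pos_aux p hp D hD hbdd h0 z).1
  have hsm := mink_smooth_aux p hp D hD hbdd h0 ψ hψ hDψ htrans
  have hmem : ∀ z, z ∈ D ↔ mink p D z < 1 := by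
    intro z
    simpa [wAct_one_aux] using key z 1 one_pos
  have hfr0 : ∀ ξ ∈ frontier D, ξ ≠ 0 := by
    rintro ξ hξ rfl
    rw [hD.1.frontier_eq] at hξ
    exact hξ.2 h0
  have hfr : ∀ ξ, ξ ∈ frontier D ↔ mink p D ξ = 1 := by
    intro ξ
    refine ⟨fun hξ => ?_, mink_frontier_aux p hp D hD hbdd h0 ξ⟩
    have hξ0 := hfr0 ξ hξ
    rw [hD.1.frontier_eq] at hξ
    apply le_antisymm
    · by_contra! h
      have h1 := (hsm ξ hξ0).continuousAt.eventually (lt_mem_nhds h)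
      obtain ⟨w, hw, hwD⟩ := mem_closure_iff_nhds.1 hξ.1 _ h1
      exact lt_asymm hw ((hmem w).1 hwD)
    · exact not_lt.1 fun h => hξ.2 ((hmem ξ).2 h)
  refine ⟨fun z hz => ((hsm z hz).sub contDiffAt_const).contDiffWithinAt, ?_, ?_, ?_⟩
  · ext z
    simp only [Set.mem_setOf_eq, sub_neg]
    exact hmem z
  · ext z
    simp only [Set.mem_setOf_eq, sub_eq_zero]
    exact hfr z
  · intro ξ hξ hzero
    have hξ0 := hfr0 ξ hξ
    have h1 : HasFDerivAt (fun z => mink p D z - 1) (0 : (Fin n → ℂ) →L[ℝ] ℝ)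
        (wAct p ((1 : ℝ) : ℂ) ξ) := by
      rw [Complex.ofReal_one, wAct_one_aux, ← hzero]
      exact (((hsm ξ hξ0).sub contDiffAt_const).differentiableAt (by simp)).hasFDerivAt
    have h2 := h1.comp_hasDerivAt (1 : ℝ) (wAct_deriv_aux p hp ξ 1 one_pos)
    have h3 : HasDerivAt (fun s : ℝ => s - 1) 1 1 := (hasDerivAt_id (1 : ℝ)).sub_const 1
    have h4 : (fun s : ℝ => s - 1) =ᶠ[nhds 1]
        ((fun z => mink p D z - 1) ∘ fun s : ℝ => wAct p (s : ℂ) ξ) := by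
      filter_upwards [lt_mem_nhds (one_pos : (0 : ℝ) < 1)] with s hs
      simp only [Function.comp]
      rw [mink_homog_aux p hp D hD hbdd h0 ξ hξ0 s hs, (hfr ξ).1 hξ, mul_one]
    have h5 := h3.unique (h2.congr_of_eventuallyEq h4)
    simp at h5
end
end
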